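/- In the first-price auction with an arbitrary partition of the bidders into utility maximizers B_u and value maximizers B_v, for every equilibrium strategy profile, Σ_i E[val i] ≥ c · Σ_j max_i v i j, where c = min over t ∈ [0,1] of (1 + t·ln t)/(2 − t + t·ln t) (with the convention 0·ln 0 = 0). That is, the price of anarchy of the first-price auction in the mixed autobidding world is at least min_{t∈[0,1]} (1 + t ln t)/(2 − t + t ln t) ≈ 0.457. -/

import Mathlib

open MeasureTheory Finset
open scoped Classical

namespace FPA

variable {n m : ℕ}

/-- Bidder `i` wins auction `j` under bid profile `b`: highest bid, ties broken
in favor of larger value, then smaller index. -/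
def Wins (v b : Fin n → Fin m → ℝ) (j : Fin m) (i : Fin n) : Prop :=
  ∀ i', i' ≠ i →
    b i' j < b i j ∨ (b i' j = b i j ∧ (v i' j < v i j ∨ (v i' j = v i j ∧ i < i')))

/-- Indicator that bidder `i` wins auction `j`. -/
noncomputable def xind (v b : Fin n → Fin m → ℝ) (j : Fin m) (i : Fin n) : ℝ :=
  if Wins v b j i then 1 else 0

noncomputable def valij (v b : Fin n → Fin m → ℝ) (i : Fin n) (j : Fin m) : ℝ :=
  xind v b j i * v i j

noncomputable def payij (v b : Fin n → Fin m → ℝ) (i : Fin n) (j : Fin m) : ℝ :=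
  xind v b j i * b i j

/-- Admissible strategy: probability distribution over nonnegative bid vectors
with finite expectations. -/
def Admissible (σ : Measure (Fin m → ℝ)) : Prop :=
  IsProbabilityMeasure σ ∧ (∀ᵐ β ∂σ, ∀ j, 0 ≤ β j) ∧ ∀ j, Integrable (fun β => β j) σ

noncomputable def EValij (v : Fin n → Fin m → ℝ) (μ : Fin n → Measure (Fin m → ℝ))
    (i : Fin n) (j : Fin m) : ℝ :=
  ∫ b, valij v b i j ∂(Measure.pi μ)

noncomputable def EPayij (v : Fin n → Fin m → ℝ) (μ : Fin n → Measure (Fin m → ℝ))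
    (i : Fin n) (j : Fin m) : ℝ :=
  ∫ b, payij v b i j ∂(Measure.pi μ)

noncomputable def EVal (v : Fin n → Fin m → ℝ) (μ : Fin n → Measure (Fin m → ℝ))
    (i : Fin n) : ℝ :=
  ∑ j, EValij v μ i j

noncomputable def EPay (v : Fin n → Fin m → ℝ) (μ : Fin n → Measure (Fin m → ℝ))
    (i : Fin n) : ℝ :=
  ∑ j, EPayij v μ i j

noncomputable def EUtil (v : Fin n → Fin m → ℝ) (μ : Fin n → Measure (Fin m → ℝ))
    (i : Fin n) : ℝ :=
  EVal v μ i - EPay v μ i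

/-- A utility maximizer best responds: no admissible deviation improves expected utility. -/
def UtilBest (v : Fin n → Fin m → ℝ) (μ : Fin n → Measure (Fin m → ℝ)) (i : Fin n) : Prop :=
  ∀ σ, Admissible σ → EUtil v (Function.update μ i σ) i ≤ EUtil v μ i

/-- A value maximizer best responds: its ROI constraint holds and no admissible
deviation satisfying the ROI constraint yields more expected value. -/
def ValBest (v : Fin n → Fin m → ℝ) (μ : Fin n → Measure (Fin m → ℝ)) (i : Fin n) : Prop :=
  EPay v μ i ≤ EVal v μ i ∧
    ∀ σ, Admissible σ →
      EPay v (Function.update μ i σ) i ≤ EVal v (Function.update μ i σ) i →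
      EVal v (Function.update μ i σ) i ≤ EVal v μ i

/-- Equilibrium: all strategies admissible, every utility maximizer in `Bu` and
every value maximizer in `Bv` best responds. -/
def Equilibrium (v : Fin n → Fin m → ℝ) (Bu Bv : Finset (Fin n))
    (μ : Fin n → Measure (Fin m → ℝ)) : Prop :=
  (∀ i, Admissible (μ i)) ∧ (∀ i ∈ Bu, UtilBest v μ i) ∧ (∀ i ∈ Bv, ValBest v μ i)

/-- The rightful winner of auction `j`: the bidder with the highest value,
ties broken toward the smaller index. -/
noncomputable def rwinner [NeZero n] (v : Fin n → Fin m → ℝ) (j : Fin m) : Fin n :=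
  (Finset.univ.filter fun i => ∀ i', v i' j ≤ v i j).min' (by
    obtain ⟨i, -, hi⟩ := Finset.exists_max_image (Finset.univ : Finset (Fin n))
      (fun i => v i j) Finset.univ_nonempty
    exact ⟨i, Finset.mem_filter.mpr ⟨Finset.mem_univ _, fun i' => hi i' (Finset.mem_univ _)⟩⟩)

end FPA

open MeasureTheory Finset

/-- The price-of-anarchy constant `min_{t ∈ [0,1]} (1 + t ln t)/(2 - t + t ln t)`
(with the convention `0 · ln 0 = 0`, which holds definitionally since
`Real.log 0 = 0`). -/
noncomputable def mixedPoAConst : ℝ :=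
  sInf ((fun t : ℝ => (1 + t * Real.log t) / (2 - t + t * Real.log t)) '' Set.Icc 0 1)

namespace FPA

/-- Every auction has a winner. -/
lemma exists_wins {n m : ℕ} [NeZero n] (v b : Fin n → Fin m → ℝ) (j : Fin m) :
    ∃ i, Wins v b j i ∧ ∀ k, b k j ≤ b i j := by
  obtain ⟨i, -, hi⟩ := Finset.exists_max_image (Finset.univ : Finset (Fin n))
    (fun i => toLex (b i j, toLex (v i j, OrderDual.toDual i))) Finset.univ_nonempty
  have key : ∀ k, b k j < b i j ∨ b k j = b i j ∧ (v k j < v i j ∨ v k j = v i j ∧ i ≤ k) := by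
    intro k
    have h := hi k (Finset.mem_univ _)
    simpa only [Prod.Lex.toLex_le_toLex, OrderDual.toDual_le_toDual] using h
  refine ⟨i, fun k hk => ?_, fun k => ?_⟩
  · rcases key k with h | ⟨h, h' | ⟨h', h''⟩⟩
    · exact Or.inl h
    · exact Or.inr ⟨h, Or.inl h'⟩
    · exact Or.inr ⟨h, Or.inr ⟨h', lt_of_le_of_ne h'' (Ne.symm hk)⟩⟩
  · rcases key k with h | ⟨h, -⟩
    · exact h.le
    · exact h.le

lemma rwinner_spec {n m : ℕ} [NeZero n] (v : Fin n → Fin m → ℝ) (j : Fin m) (i : Fin n) :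
    v i j ≤ v (rwinner v j) j ∧ (v i j = v (rwinner v j) j → rwinner v j ≤ i) := by
  have hmem : rwinner v j ∈ Finset.univ.filter fun i => ∀ i', v i' j ≤ v i j :=
    Finset.min'_mem _ _
  have hmax := (Finset.mem_filter.mp hmem).2
  refine ⟨hmax i, fun h => Finset.min'_le _ _ (Finset.mem_filter.mpr ⟨Finset.mem_univ _, ?_⟩)⟩
  intro k
  rw [h]
  exact hmax k

lemma sup'_eq_rwinner {n m : ℕ} [NeZero n] (v : Fin n → Fin m → ℝ) (j : Fin m) :
    (Finset.univ.sup' Finset.univ_nonempty fun i => v i j) = v (rwinner v j) j :=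
  le_antisymm (Finset.sup'_le _ _ fun i _ => (rwinner_spec v j i).1)
    (Finset.le_sup' (fun i => v i j) (Finset.mem_univ _))

/-- Bid profiles in which every competitor of bidder `i` bids at most `c` in auction `j`. -/
def competitorsLE {n m : ℕ} (i : Fin n) (j : Fin m) (c : ℝ) : Set (Fin n → Fin m → ℝ) :=
  {b | ∀ k, k ≠ i → b k j ≤ c}

lemma wins_rwinner {n m : ℕ} [NeZero n] {v b : Fin n → Fin m → ℝ} {j : Fin m}
    (h : b ∈ competitorsLE (rwinner v j) j (b (rwinner v j) j)) : Wins v b j (rwinner v j) := by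
  intro k hk
  rcases (h k hk).lt_or_eq with h1 | h1
  · exact Or.inl h1
  · refine Or.inr ⟨h1, ?_⟩
    obtain ⟨h2, h3⟩ := rwinner_spec v j k
    rcases h2.lt_or_eq with h4 | h4
    · exact Or.inl h4
    · exact Or.inr ⟨h4, lt_of_le_of_ne (h3 h4) (Ne.symm hk)⟩

lemma measurableSet_competitorsLE {n m : ℕ} (i : Fin n) (j : Fin m) (c : ℝ) :
    MeasurableSet (competitorsLE i j c) := by
  have : competitorsLE i j c = ⋂ k, ⋂ (_ : k ≠ i), {b | b k j ≤ c} := by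
    ext b; simp [competitorsLE]
  rw [this]
  exact MeasurableSet.iInter fun k => MeasurableSet.iInter fun _ =>
    measurableSet_le (by fun_prop) measurable_const

/-- The probability that all competitors of `i` bid at most `c` in auction `j`. -/
noncomputable def competitorCDF {n m : ℕ} (μ : Fin n → Measure (Fin m → ℝ)) (i : Fin n)
    (j : Fin m) (c : ℝ) : ℝ :=
  (Measure.pi μ).real (competitorsLE i j c)

lemma pi_competitorsLE {n m : ℕ} (μ : Fin n → Measure (Fin m → ℝ))
    [∀ i, IsProbabilityMeasure (μ i)] (i : Fin n) (j : Fin m) (c : ℝ) :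
    Measure.pi μ (competitorsLE i j c) = ∏ k, if k = i then 1 else μ k {β | β j ≤ c} := by
  have : competitorsLE i j c =
      Set.univ.pi fun k => if k = i then Set.univ else {β : Fin m → ℝ | β j ≤ c} := by
    ext b
    simp only [competitorsLE, Set.mem_ofPred_eq, Set.mem_univ_pi]
    refine forall_congr' fun k => ?_
    by_cases hk : k = i <;> simp [hk]
  rw [this, Measure.pi_pi]
  refine Finset.prod_congr rfl fun k _ => ?_
  by_cases hk : k = i <;> simp [hk]

lemma isProbabilityMeasure_update {n m : ℕ} (μ : Fin n → Measure (Fin m → ℝ))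
    [∀ i, IsProbabilityMeasure (μ i)] (i : Fin n) (σ : Measure (Fin m → ℝ))
    [IsProbabilityMeasure σ] (k : Fin n) : IsProbabilityMeasure (Function.update μ i σ k) := by
  by_cases hk : k = i
  · subst hk; simpa
  · rw [Function.update_of_ne hk]; infer_instance

lemma competitorCDF_update {n m : ℕ} (μ : Fin n → Measure (Fin m → ℝ))
    [∀ i, IsProbabilityMeasure (μ i)] (i : Fin n) (σ : Measure (Fin m → ℝ))
    [IsProbabilityMeasure σ] (j : Fin m) (c : ℝ) :
    competitorCDF (Function.update μ i σ) i j c = competitorCDF μ i j c := by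
  have := isProbabilityMeasure_update μ i σ
  unfold competitorCDF
  rw [measureReal_def, measureReal_def, pi_competitorsLE, pi_competitorsLE]
  congr 1
  refine Finset.prod_congr rfl fun k _ => ?_
  by_cases hk : k = i
  · simp [hk]
  · simp [hk]

lemma measurable_xind {n m : ℕ} (v : Fin n → Fin m → ℝ) (j : Fin m) (i : Fin n) :
    Measurable fun b => xind v b j i := by
  have hset : MeasurableSet {b | Wins v b j i} := by
    have : {b | Wins v b j i} = ⋂ k, ⋂ (_ : k ≠ i), ({b | b k j < b i j} ∪
        ({b | b k j = b i j} ∩ {_b | v k j < v i j ∨ (v k j = v i j ∧ i < k)})) := by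
      ext b; simp [Wins]
    rw [this]
    refine MeasurableSet.iInter fun k => MeasurableSet.iInter fun _ => ?_
    exact (measurableSet_lt (by fun_prop) (by fun_prop)).union
      ((measurableSet_eq_fun (by fun_prop) (by fun_prop)).inter (MeasurableSet.const _))
  exact Measurable.ite hset measurable_const measurable_const

lemma xind_nonneg {n m : ℕ} (v b : Fin n → Fin m → ℝ) (j : Fin m) (i : Fin n) :
    0 ≤ xind v b j i := by
  unfold xind; split_ifs <;> norm_num

lemma xind_le_one {n m : ℕ} (v b : Fin n → Fin m → ℝ) (j : Fin m) (i : Fin n) :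
    xind v b j i ≤ 1 := by
  unfold xind; split_ifs <;> norm_num

lemma integrable_xind {n m : ℕ} (v : Fin n → Fin m → ℝ) (μ : Fin n → Measure (Fin m → ℝ))
    [∀ i, IsProbabilityMeasure (μ i)] (j : Fin m) (i : Fin n) :
    Integrable (fun b => xind v b j i) (Measure.pi μ) :=
  Integrable.of_bound (measurable_xind v j i).aestronglyMeasurable 1
    (Filter.Eventually.of_forall fun b => by
      rw [Real.norm_of_nonneg (xind_nonneg ..)]; exact xind_le_one ..)

lemma integrable_payij {n m : ℕ} (v : Fin n → Fin m → ℝ) {μ : Fin n → Measure (Fin m → ℝ)}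
    [∀ i, IsProbabilityMeasure (μ i)] {i : Fin n} {j : Fin m}
    (h : Integrable (fun β => β j) (μ i)) :
    Integrable (fun b => payij v b i j) (Measure.pi μ) :=
  Integrable.bdd_mul (c := 1)
    (integrable_comp_eval (μ := μ) (i := i) (f := fun β : Fin m → ℝ => β j) h)
    (measurable_xind v j i).aestronglyMeasurable
    (Filter.Eventually.of_forall fun b => by
      rw [Real.norm_of_nonneg (xind_nonneg ..)]; exact xind_le_one ..)

lemma ae_bids_nonneg {n m : ℕ} {μ : Fin n → Measure (Fin m → ℝ)}
    [∀ i, IsProbabilityMeasure (μ i)] (hμ : ∀ i, Admissible (μ i)) :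
    ∀ᵐ b ∂Measure.pi μ, ∀ i j, 0 ≤ b i j :=
  ae_all_iff.mpr fun i =>
    (Measure.tendsto_eval_ae_ae (μ := μ) (i := i)).eventually (hμ i).2.1

/-- The winning probability of bidder `i` in auction `j`. -/
noncomputable def winProb {n m : ℕ} (v : Fin n → Fin m → ℝ) (μ : Fin n → Measure (Fin m → ℝ))
    (i : Fin n) (j : Fin m) : ℝ :=
  ∫ b, xind v b j i ∂Measure.pi μ

lemma winProb_nonneg {n m : ℕ} (v : Fin n → Fin m → ℝ) (μ : Fin n → Measure (Fin m → ℝ))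
    (i : Fin n) (j : Fin m) : 0 ≤ winProb v μ i j :=
  integral_nonneg fun _ => xind_nonneg ..

lemma EValij_eq {n m : ℕ} (v : Fin n → Fin m → ℝ) (μ : Fin n → Measure (Fin m → ℝ))
    (i : Fin n) (j : Fin m) : EValij v μ i j = v i j * winProb v μ i j := by
  unfold EValij winProb valij
  rw [integral_mul_const, mul_comm]

lemma ae_eq_of_update_dirac {n m : ℕ} (μ : Fin n → Measure (Fin m → ℝ))
    [∀ i, IsProbabilityMeasure (μ i)] (i : Fin n) (β : Fin m → ℝ) :
    ∀ᵐ b ∂Measure.pi (Function.update μ i (Measure.dirac β)), b i = β := by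
  have := isProbabilityMeasure_update μ i (Measure.dirac β)
  refine (Measure.tendsto_eval_ae_ae (μ := Function.update μ i (Measure.dirac β))
    (i := i)).eventually (p := fun x => x = β) ?_
  rw [Function.update_self, ae_dirac_eq]
  rfl

lemma EPayij_update_dirac {n m : ℕ} (v : Fin n → Fin m → ℝ) (μ : Fin n → Measure (Fin m → ℝ))
    [∀ i, IsProbabilityMeasure (μ i)] (i : Fin n) (β : Fin m → ℝ) (j : Fin m) :
    EPayij v (Function.update μ i (Measure.dirac β)) i j =
      β j * winProb v (Function.update μ i (Measure.dirac β)) i j := by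
  unfold EPayij winProb payij
  rw [mul_comm, ← integral_mul_const]
  refine integral_congr_ae ?_
  filter_upwards [ae_eq_of_update_dirac μ i β] with b hb
  rw [hb]

lemma competitorCDF_le_winProb {n m : ℕ} [NeZero n] (v : Fin n → Fin m → ℝ)
    (μ : Fin n → Measure (Fin m → ℝ)) [∀ i, IsProbabilityMeasure (μ i)] (i : Fin n)
    (β : Fin m → ℝ) {j : Fin m} (hj : rwinner v j = i) :
    competitorCDF μ i j (β j) ≤
      winProb v (Function.update μ i (Measure.dirac β)) i j := by
  have := isProbabilityMeasure_update μ i (Measure.dirac β)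
  rw [← competitorCDF_update μ i (Measure.dirac β)]
  unfold competitorCDF winProb
  rw [← integral_indicator_one (measurableSet_competitorsLE i j (β j))]
  refine integral_mono_ae ?_ (integrable_xind ..) ?_
  · exact (integrable_const (1 : ℝ)).indicator (measurableSet_competitorsLE i j (β j))
  filter_upwards [ae_eq_of_update_dirac μ i β] with b hb
  by_cases h : b ∈ competitorsLE i j (β j)
  · have hw : Wins v b j i := by
      subst hj
      apply wins_rwinner
      rwa [hb]
    simp [h, xind, hw]
  · simpa [h] using xind_nonneg v b j i

lemma admissible_dirac {m : ℕ} {β : Fin m → ℝ} (hβ : ∀ j, 0 ≤ β j) :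
    Admissible (Measure.dirac β) := by
  refine ⟨inferInstance, ?_, fun j => ?_⟩
  · rw [ae_dirac_eq]; exact hβ
  · exact integrable_dirac (by simp)

lemma sum_le_EUtil {n m : ℕ} [NeZero n] {v : Fin n → Fin m → ℝ} (hv : ∀ i j, 0 ≤ v i j)
    {μ : Fin n → Measure (Fin m → ℝ)} [∀ i, IsProbabilityMeasure (μ i)] {i : Fin n}
    (hi : UtilBest v μ i) {β : Fin m → ℝ}
    (hβ : ∀ j, rwinner v j = i → 0 ≤ β j ∧ β j ≤ v i j) :
    ∑ j, (if rwinner v j = i then (v i j - β j) * competitorCDF μ i j (β j) else 0) ≤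
      EUtil v μ i := by
  set β' : Fin m → ℝ := fun j => if rwinner v j = i then β j else 0 with hβ'
  have h0 : ∀ j, 0 ≤ β' j := by
    intro j
    by_cases h : rwinner v j = i
    · simpa [hβ', h] using (hβ j h).1
    · simp [hβ', h]
  refine le_trans ?_ (hi _ (admissible_dirac h0))
  unfold EUtil EVal EPay
  rw [← Finset.sum_sub_distrib]
  refine Finset.sum_le_sum fun j _ => ?_
  rw [EValij_eq, EPayij_update_dirac, ← sub_mul]
  by_cases h : rwinner v j = i
  · have hq := competitorCDF_le_winProb v μ i β' h
    have hb : β' j = β j := by simp [hβ', h]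
    rw [hb] at hq ⊢
    rw [if_pos h]
    exact mul_le_mul_of_nonneg_left hq (sub_nonneg.mpr (hβ j h).2)
  · have hb : β' j = 0 := by simp [hβ', h]
    rw [hb, if_neg h, sub_zero]
    exact mul_nonneg (hv i j) (winProb_nonneg ..)

lemma sum_le_EVal {n m : ℕ} [NeZero n] {v : Fin n → Fin m → ℝ} (hv : ∀ i j, 0 ≤ v i j)
    {μ : Fin n → Measure (Fin m → ℝ)} [∀ i, IsProbabilityMeasure (μ i)] {i : Fin n}
    (hi : ValBest v μ i) :
    ∑ j, (if rwinner v j = i then v i j * competitorCDF μ i j (v i j) else 0) ≤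
      EVal v μ i := by
  refine le_trans ?_ (hi.2 _ (admissible_dirac (hv i)) ?_)
  · refine Finset.sum_le_sum fun j _ => ?_
    rw [EValij_eq]
    split_ifs with h
    · exact mul_le_mul_of_nonneg_left (competitorCDF_le_winProb v μ i (v i) h) (hv i j)
    · exact mul_nonneg (hv i j) (winProb_nonneg ..)
  · refine (Finset.sum_congr rfl fun j _ => ?_).le
    rw [EValij_eq, EPayij_update_dirac]

/-- The expected revenue of auction `j`. -/
noncomputable def revenue {n m : ℕ} (v : Fin n → Fin m → ℝ) (μ : Fin n → Measure (Fin m → ℝ))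
    (j : Fin m) : ℝ :=
  ∫ b, ∑ i, payij v b i j ∂Measure.pi μ

lemma sum_EPay_eq {n m : ℕ} (v : Fin n → Fin m → ℝ) {μ : Fin n → Measure (Fin m → ℝ)}
    [∀ i, IsProbabilityMeasure (μ i)] (hμ : ∀ i, Admissible (μ i)) :
    ∑ i, EPay v μ i = ∑ j, revenue v μ j := by
  unfold EPay
  rw [Finset.sum_comm]
  refine Finset.sum_congr rfl fun j _ => ?_
  unfold revenue
  rw [integral_finsetSum _ fun i _ => integrable_payij v ((hμ i).2.2 j)]
  rfl

lemma EPay_nonneg {n m : ℕ} (v : Fin n → Fin m → ℝ) {μ : Fin n → Measure (Fin m → ℝ)}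
    [∀ i, IsProbabilityMeasure (μ i)] (hμ : ∀ i, Admissible (μ i)) (i : Fin n) :
    0 ≤ EPay v μ i := by
  refine Finset.sum_nonneg fun j _ => integral_nonneg_of_ae ?_
  filter_upwards [ae_bids_nonneg hμ] with b hb
  exact mul_nonneg (xind_nonneg ..) (hb i j)

lemma sum_payij_nonneg {n m : ℕ} (v : Fin n → Fin m → ℝ) {b : Fin n → Fin m → ℝ}
    (hb : ∀ i j, 0 ≤ b i j) (j : Fin m) : 0 ≤ ∑ i, payij v b i j :=
  Finset.sum_nonneg fun i _ => mul_nonneg (xind_nonneg ..) (hb i j)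

lemma bid_le_sum_payij {n m : ℕ} [NeZero n] (v : Fin n → Fin m → ℝ) {b : Fin n → Fin m → ℝ}
    (hb : ∀ i j, 0 ≤ b i j) (k : Fin n) (j : Fin m) : b k j ≤ ∑ i, payij v b i j := by
  obtain ⟨i, hi, hmax⟩ := exists_wins v b j
  calc b k j ≤ b i j := hmax k
    _ = payij v b i j := by simp [payij, xind, hi]
    _ ≤ ∑ i, payij v b i j := Finset.single_le_sum (f := fun i => payij v b i j)
        (fun i _ => mul_nonneg (xind_nonneg ..) (hb i j)) (Finset.mem_univ i)

lemma one_sub_competitorCDF_le {n m : ℕ} [NeZero n] (v : Fin n → Fin m → ℝ)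
    {μ : Fin n → Measure (Fin m → ℝ)} [∀ i, IsProbabilityMeasure (μ i)]
    (hμ : ∀ i, Admissible (μ i)) (i : Fin n) (j : Fin m) (c : ℝ) :
    1 - competitorCDF μ i j c ≤ (Measure.pi μ).real {b | c ≤ ∑ i, payij v b i j} := by
  unfold competitorCDF
  rw [← probReal_compl_eq_one_sub (measurableSet_competitorsLE i j c)]
  unfold Measure.real
  refine ENNReal.toReal_mono (measure_ne_top _ _) (measure_mono_ae ?_)
  filter_upwards [ae_bids_nonneg hμ] with b hb hmem
  have hmem' : ¬ ∀ k, k ≠ i → b k j ≤ c := hmem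
  push Not at hmem'
  obtain ⟨k, -, hk⟩ := hmem'
  exact hk.le.trans (bid_le_sum_payij v hb k j)

lemma integrable_sum_payij {n m : ℕ} (v : Fin n → Fin m → ℝ) {μ : Fin n → Measure (Fin m → ℝ)}
    [∀ i, IsProbabilityMeasure (μ i)] (hμ : ∀ i, Admissible (μ i)) (j : Fin m) :
    Integrable (fun b => ∑ i, payij v b i j) (Measure.pi μ) :=
  integrable_finsetSum _ fun i _ => integrable_payij v ((hμ i).2.2 j)

lemma ae_sum_payij_nonneg {n m : ℕ} (v : Fin n → Fin m → ℝ) {μ : Fin n → Measure (Fin m → ℝ)}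
    [∀ i, IsProbabilityMeasure (μ i)] (hμ : ∀ i, Admissible (μ i)) (j : Fin m) :
    0 ≤ᵐ[Measure.pi μ] fun b => ∑ i, payij v b i j := by
  filter_upwards [ae_bids_nonneg hμ] with b hb using sum_payij_nonneg v hb j

lemma revenue_nonneg {n m : ℕ} (v : Fin n → Fin m → ℝ) {μ : Fin n → Measure (Fin m → ℝ)}
    [∀ i, IsProbabilityMeasure (μ i)] (hμ : ∀ i, Admissible (μ i)) (j : Fin m) :
    0 ≤ revenue v μ j :=
  integral_nonneg_of_ae (ae_sum_payij_nonneg v hμ j)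

lemma mul_one_sub_competitorCDF_le_revenue {n m : ℕ} [NeZero n] (v : Fin n → Fin m → ℝ)
    {μ : Fin n → Measure (Fin m → ℝ)} [∀ i, IsProbabilityMeasure (μ i)]
    (hμ : ∀ i, Admissible (μ i)) (i : Fin n) (j : Fin m) {c : ℝ} (hc : 0 ≤ c) :
    c * (1 - competitorCDF μ i j c) ≤ revenue v μ j :=
  (mul_le_mul_of_nonneg_left (one_sub_competitorCDF_le v hμ i j c) hc).trans
    (mul_meas_ge_le_integral_of_nonneg (ae_sum_payij_nonneg v hμ j)
      (integrable_sum_payij v hμ j) c)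

/-- Truncated layer-cake lower bound for the expectation of a nonnegative variable. -/
lemma intervalIntegral_measureReal_le {Ω : Type*} [MeasurableSpace Ω] {P : Measure Ω}
    [IsProbabilityMeasure P] {R : Ω → ℝ} (hR : Integrable R P) (h0 : 0 ≤ᵐ[P] R) {a : ℝ}
    (ha : 0 ≤ a) {g : ℝ → ℝ} (hg : IntervalIntegrable g volume 0 a)
    (h : ∀ b ∈ Set.Ioo 0 a, g b ≤ P.real {ω | b ≤ R ω}) :
    ∫ b in (0 : ℝ)..a, g b ≤ ∫ ω, R ω ∂P := by
  have hmin : Integrable (fun ω => min (R ω) a) P := hR.inf (integrable_const a)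
  have hlayer := hmin.integral_eq_integral_Ioc_meas_le (M := a)
    (by filter_upwards [h0] with ω hω using le_min hω ha)
    (Filter.Eventually.of_forall fun ω => min_le_right _ _)
  rw [← intervalIntegral.integral_of_le ha] at hlayer
  calc ∫ b in (0 : ℝ)..a, g b
      ≤ ∫ b in (0 : ℝ)..a, P.real {ω | b ≤ min (R ω) a} := by
        refine intervalIntegral.integral_mono_on_of_le_Ioo ha hg
          (AntitoneOn.intervalIntegrable ?_) ?_
        · intro x _ y _ hxy
          exact measureReal_mono fun ω hω => hxy.trans hω
        · intro b hb
          refine (h b hb).trans (measureReal_mono fun ω hω => le_min hω hb.2.le)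
    _ = ∫ ω, min (R ω) a ∂P := hlayer.symm
    _ ≤ ∫ ω, R ω ∂P := integral_mono hmin hR fun ω => min_le_left _ _

lemma intervalIntegral_one_sub_div {T w : ℝ} (hT : 0 < T) (hTw : T ≤ w) :
    IntervalIntegrable (fun b => 1 - T * (w - b)⁻¹) volume 0 (w - T) ∧
      ∫ b in (0 : ℝ)..(w - T), (1 - T * (w - b)⁻¹) = w - T + T * Real.log (T / w) := by
  have hcont : ContinuousOn (fun b : ℝ => T * (w - b)⁻¹) (Set.uIcc 0 (w - T)) := by
    refine continuousOn_const.mul (ContinuousOn.inv₀ (by fun_prop) fun b hb => ?_)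
    rw [Set.uIcc_of_le (by linarith)] at hb
    have := hb.2
    intro h
    linarith
  have hint := hcont.intervalIntegrable (μ := volume)
  refine ⟨intervalIntegrable_const.sub hint, ?_⟩
  rw [intervalIntegral.integral_sub intervalIntegrable_const hint,
    intervalIntegral.integral_const_mul,
    intervalIntegral.integral_comp_sub_left (fun x => x⁻¹) w, sub_sub_cancel, sub_zero,
    integral_inv_of_pos hT (hT.trans_le hTw),
    Real.log_div (hT.trans_le hTw).ne' hT.ne', Real.log_div hT.ne' (hT.trans_le hTw).ne']
  simp
  ring

lemma le_revenue_of_competitorCDF {n m : ℕ} [NeZero n] (v : Fin n → Fin m → ℝ)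
    {μ : Fin n → Measure (Fin m → ℝ)} [∀ i, IsProbabilityMeasure (μ i)]
    (hμ : ∀ i, Admissible (μ i)) (i : Fin n) (j : Fin m) {T w : ℝ} (hT : 0 ≤ T) (hTw : T ≤ w)
    (h : ∀ b ∈ Set.Icc 0 w, (w - b) * competitorCDF μ i j b ≤ T) :
    w - T + T * Real.log (T / w) ≤ revenue v μ j := by
  have key : ∀ b ∈ Set.Ioo 0 (w - T),
      1 - T * (w - b)⁻¹ ≤ (Measure.pi μ).real {b' | b ≤ ∑ i, payij v b' i j} := by
    intro b hb
    refine le_trans ?_ (one_sub_competitorCDF_le v hμ i j b)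
    have hpos : 0 < w - b := by linarith [hb.2]
    have := h b ⟨hb.1.le, by linarith⟩
    rw [← div_eq_mul_inv]
    have : competitorCDF μ i j b ≤ T / (w - b) := by
      rw [le_div_iff₀ hpos]; linarith
    linarith
  rcases hT.eq_or_lt with rfl | hT'
  · have := intervalIntegral_measureReal_le (integrable_sum_payij v hμ j)
      (ae_sum_payij_nonneg v hμ j) (sub_nonneg.mpr hTw) (g := fun b => 1 - 0 * (w - b)⁻¹)
      (by simp) key
    simpa [revenue] using this
  · obtain ⟨hi, he⟩ := intervalIntegral_one_sub_div hT' hTw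
    rw [← he]
    exact intervalIntegral_measureReal_le (integrable_sum_payij v hμ j)
      (ae_sum_payij_nonneg v hμ j) (sub_nonneg.mpr hTw) hi key

/-- The best utility `sup_b (w - b) F(b)` against a competing bid with distribution `F`. -/
lemma exists_best_utility {F : ℝ → ℝ} (h0 : ∀ b, 0 ≤ F b) (h1 : ∀ b, F b ≤ 1) {w : ℝ}
    (hw : 0 ≤ w) : ∃ T, 0 ≤ T ∧ T ≤ w ∧ (∀ b ∈ Set.Icc 0 w, (w - b) * F b ≤ T) ∧
      ∀ ε > 0, ∃ b ∈ Set.Icc 0 w, T - ε ≤ (w - b) * F b := by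
  have hle : ∀ y ∈ (fun b => (w - b) * F b) '' Set.Icc 0 w, y ≤ w := by
    rintro _ ⟨b, hb, rfl⟩
    have := mul_le_of_le_one_right (sub_nonneg.mpr hb.2) (h1 b)
    have := hb.1
    dsimp only
    linarith
  have hbdd : BddAbove ((fun b => (w - b) * F b) '' Set.Icc 0 w) := ⟨w, hle⟩
  have hne : ((fun b => (w - b) * F b) '' Set.Icc 0 w).Nonempty :=
    ⟨_, 0, ⟨le_rfl, hw⟩, rfl⟩
  refine ⟨sSup ((fun b => (w - b) * F b) '' Set.Icc 0 w), ?_, csSup_le hne hle,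
    fun b hb => le_csSup hbdd ⟨b, hb, rfl⟩, fun ε hε => ?_⟩
  · refine le_csSup_of_le hbdd ⟨0, ⟨le_rfl, hw⟩, rfl⟩ ?_
    exact mul_nonneg (by linarith) (h0 0)
  · obtain ⟨_, ⟨b, hb, rfl⟩, hlt⟩ := exists_lt_of_lt_csSup hne (sub_lt_self _ hε)
    exact ⟨b, hb, hlt.le⟩

end FPA

lemma sub_one_le_mul_log {t : ℝ} (ht : 0 ≤ t) : t - 1 ≤ t * Real.log t := by
  rcases ht.eq_or_lt with rfl | h
  · simp
  · have := mul_le_mul_of_nonneg_left (Real.one_sub_inv_le_log_of_pos h) ht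
    rwa [mul_sub, mul_inv_cancel₀ h.ne', mul_one] at this

lemma mixedPoAConst_term_nonneg {t : ℝ} (ht : 0 ≤ t) :
    0 ≤ (1 + t * Real.log t) / (2 - t + t * Real.log t) := by
  have := sub_one_le_mul_log ht
  exact div_nonneg (by linarith) (by linarith)

lemma mixedPoAConst_nonneg : 0 ≤ mixedPoAConst := by
  refine Real.sInf_nonneg ?_
  rintro _ ⟨t, ht, rfl⟩
  exact mixedPoAConst_term_nonneg ht.1

lemma mixedPoAConst_le {t : ℝ} (ht : t ∈ Set.Icc (0 : ℝ) 1) :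
    mixedPoAConst ≤ (1 + t * Real.log t) / (2 - t + t * Real.log t) := by
  refine csInf_le ⟨0, ?_⟩ ⟨t, ht, rfl⟩
  rintro _ ⟨s, hs, rfl⟩
  exact mixedPoAConst_term_nonneg hs.1

lemma mixedPoAConst_le_half : mixedPoAConst ≤ 1 / 2 := by
  simpa using mixedPoAConst_le (t := 0) (by simp)

lemma mixedPoAConst_mul_le {T w : ℝ} (hT : 0 ≤ T) (hTw : T ≤ w) :
    mixedPoAConst * (w + (w - T + T * Real.log (T / w))) ≤ w + T * Real.log (T / w) := by
  rcases (hT.trans hTw).eq_or_lt with rfl | hw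
  · simp [le_antisymm hTw hT]
  have ht : T / w ∈ Set.Icc (0 : ℝ) 1 := ⟨by positivity, (div_le_one hw).mpr hTw⟩
  have hlog := sub_one_le_mul_log ht.1
  have h := mixedPoAConst_le ht
  rw [le_div_iff₀ (by linarith [ht.2])] at h
  have h2 := mul_le_mul_of_nonneg_right h hw.le
  have e : T / w * w = T := div_mul_cancel₀ _ hw.ne'
  generalize Real.log (T / w) = L at *
  generalize T / w = t at *
  subst e
  linarith

lemma sum_ite_rwinner {n m : ℕ} [NeZero n] (v : Fin n → Fin m → ℝ) (B : Finset (Fin n))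
    (f : Fin n → Fin m → ℝ) :
    ∑ i ∈ B, ∑ j, (if FPA.rwinner v j = i then f i j else 0) =
      ∑ j, if FPA.rwinner v j ∈ B then f (FPA.rwinner v j) j else 0 := by
  rw [Finset.sum_comm]
  exact Finset.sum_congr rfl fun j _ => Finset.sum_ite_eq _ _ _

/-- Theorem 2 of the paper, lower bound. In any equilibrium of the
first-price auction in the mixed autobidding world, the welfare is at least
`min_{t ∈ [0,1]} (1 + t ln t)/(2 - t + t ln t) ≈ 0.457` times the optimal welfare. -/
theorem fpa_mixed_autobidding_poa {n m : ℕ} [NeZero n]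
    (v : Fin n → Fin m → ℝ) (hv : ∀ i j, 0 ≤ v i j)
    (Bu Bv : Finset (Fin n)) (hdisj : Disjoint Bu Bv) (hcover : Bu ∪ Bv = Finset.univ)
    (μ : Fin n → Measure (Fin m → ℝ))
    (heq : FPA.Equilibrium v Bu Bv μ)
    (hOPT : 0 < ∑ j, Finset.univ.sup' Finset.univ_nonempty fun i => v i j) :
    ∑ i, FPA.EVal v μ i ≥
      mixedPoAConst * ∑ j, Finset.univ.sup' Finset.univ_nonempty fun i => v i j := by
  have : ∀ i, IsProbabilityMeasure (μ i) := fun i => (heq.1 i).1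
  have hμ := heq.1
  simp only [FPA.sup'_eq_rwinner]
  set r := FPA.rwinner v with hr
  choose T hT0 hTv hTF hTε using fun j => FPA.exists_best_utility
    (F := FPA.competitorCDF μ (r j) j) (fun _ => measureReal_nonneg)
    (fun _ => measureReal_le_one) (hv (r j) j)
  have hsplit : ∀ f : Fin n → ℝ, ∑ i, f i = ∑ i ∈ Bu, f i + ∑ i ∈ Bv, f i := fun f => by
    rw [← hcover, Finset.sum_union hdisj]
  have hmem : ∀ i, i ∈ Bu ∧ i ∉ Bv ∨ i ∉ Bu ∧ i ∈ Bv := fun i => by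
    have h1 : i ∈ Bu ∪ Bv := hcover ▸ Finset.mem_univ i
    rcases Finset.mem_union.mp h1 with h | h
    · exact Or.inl ⟨h, Finset.disjoint_left.mp hdisj h⟩
    · exact Or.inr ⟨Finset.disjoint_right.mp hdisj h, h⟩
  have hsplitj : ∀ f : Fin m → ℝ, ∑ j, f j =
      ∑ j, (if r j ∈ Bu then f j else 0) + ∑ j, (if r j ∈ Bv then f j else 0) := fun f => by
    rw [← Finset.sum_add_distrib]
    refine Finset.sum_congr rfl fun j _ => ?_
    rcases hmem (r j) with ⟨h1, h2⟩ | ⟨h1, h2⟩ <;> simp [h1, h2]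
  have hU : ∑ j, (if r j ∈ Bu then T j else 0) ≤ ∑ i ∈ Bu, FPA.EUtil v μ i := by
    rw [← sum_ite_rwinner v Bu fun _ j => T j]
    refine Finset.sum_le_sum fun i hi => ?_
    refine le_of_forall_pos_le_add fun δ hδ => ?_
    have hε : 0 < δ / (m + 1) := by positivity
    choose β hβ hβT using fun j => hTε j _ hε
    have h := FPA.sum_le_EUtil hv (heq.2.1 i hi) (β := β) (by
      rintro j rfl
      exact hβ j)
    have h2 : ∑ j, (if r j = i then T j else 0) ≤ ∑ j, ((if r j = i then
        (v i j - β j) * FPA.competitorCDF μ i j (β j) else 0) + δ / (m + 1)) := by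
      refine Finset.sum_le_sum fun j _ => ?_
      split_ifs with hj
      · subst hj
        linarith [hβT j]
      · linarith
    rw [Finset.sum_add_distrib, Finset.sum_const, Finset.card_univ, Fintype.card_fin,
      nsmul_eq_mul] at h2
    have h3 : (m : ℝ) * (δ / (m + 1)) ≤ δ := by
      rw [mul_div_assoc', div_le_iff₀ (by positivity)]
      nlinarith
    linarith
  have hV : ∑ j, (if r j ∈ Bv then v (r j) j else 0) ≤
      ∑ i ∈ Bv, FPA.EVal v μ i + ∑ j, (if r j ∈ Bv then FPA.revenue v μ j else 0) := by
    have h : ∑ j, (if r j ∈ Bv then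
        v (r j) j * FPA.competitorCDF μ (r j) j (v (r j) j) else 0) ≤
        ∑ i ∈ Bv, FPA.EVal v μ i := by
      rw [← sum_ite_rwinner v Bv fun i j => v i j * FPA.competitorCDF μ i j (v i j)]
      exact Finset.sum_le_sum fun i hi => FPA.sum_le_EVal hv (heq.2.2 i hi)
    refine le_trans ?_ (add_le_add_left h _)
    rw [← Finset.sum_add_distrib]
    refine Finset.sum_le_sum fun j _ => ?_
    split_ifs
    · linarith [FPA.mul_one_sub_competitorCDF_le_revenue v hμ (r j) j (hv (r j) j)]
    · simp
  have hRu : ∑ j, (if r j ∈ Bu then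
      v (r j) j - T j + T j * Real.log (T j / v (r j) j) else 0) ≤
      ∑ j, (if r j ∈ Bu then FPA.revenue v μ j else 0) := by
    refine Finset.sum_le_sum fun j _ => ?_
    split_ifs
    · exact FPA.le_revenue_of_competitorCDF v hμ (r j) j (hT0 j) (hTv j) (hTF j)
    · exact le_rfl
  have hRv : 0 ≤ ∑ j, (if r j ∈ Bv then FPA.revenue v μ j else 0) :=
    Finset.sum_nonneg fun j _ => by
      split_ifs
      · exact FPA.revenue_nonneg v hμ j
      · exact le_rfl
  have hRev := FPA.sum_EPay_eq v hμ
  rw [hsplit, hsplitj] at hRev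
  have hPu : 0 ≤ ∑ i ∈ Bu, FPA.EPay v μ i :=
    Finset.sum_nonneg fun i _ => FPA.EPay_nonneg v hμ i
  have hPv : ∑ i ∈ Bv, FPA.EPay v μ i ≤ ∑ i ∈ Bv, FPA.EVal v μ i :=
    Finset.sum_le_sum fun i hi => (heq.2.2 i hi).1
  have hEU : ∑ i ∈ Bu, FPA.EUtil v μ i =
      ∑ i ∈ Bu, FPA.EVal v μ i - ∑ i ∈ Bu, FPA.EPay v μ i := by
    rw [← Finset.sum_sub_distrib]; rfl
  have hc : mixedPoAConst * (∑ j, (if r j ∈ Bu then v (r j) j else 0) +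
      ∑ j, (if r j ∈ Bu then v (r j) j - T j + T j * Real.log (T j / v (r j) j) else 0)) ≤
      ∑ j, (if r j ∈ Bu then T j else 0) +
      ∑ j, (if r j ∈ Bu then v (r j) j - T j + T j * Real.log (T j / v (r j) j) else 0) := by
    rw [← Finset.sum_add_distrib, ← Finset.sum_add_distrib, Finset.mul_sum]
    refine Finset.sum_le_sum fun j _ => ?_
    split_ifs
    · linarith [mixedPoAConst_mul_le (hT0 j) (hTv j)]
    · simp
  rw [ge_iff_le, hsplit, hsplitj]
  have hc0 := mixedPoAConst_nonneg
  have hc2 := mixedPoAConst_le_half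
  generalize ∑ j, (if r j ∈ Bu then v (r j) j else 0) = Ou at *
  generalize ∑ j, (if r j ∈ Bv then v (r j) j else 0) = Ov at *
  generalize ∑ j, (if r j ∈ Bu then
    v (r j) j - T j + T j * Real.log (T j / v (r j) j) else 0) = D at *
  rcases le_total Ov D with hle | hle
  · have := mul_le_mul_of_nonneg_left hle hc0
    linarith
  · have := mul_le_mul_of_nonneg_right hc2 (sub_nonneg.mpr hle)
    linarith
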